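/- Suppose f : ℝ^d → ℝ is real-valued with f̂ ∈ L¹(ℝ^d), ‖f‖_{B^{1,log}} < ∞ and ‖f‖_{B¹} > 0. For any m ∈ ℕ and any compact set Ω ⊂ ℝ^d, setting C₂ = C₂(Ω) = max{1, diam(Ω)}, there exists a ReLU network F : ℝ^d → ℝ of width d+4 and depth at most 6m·C₂·log₂(2+C₂)·‖f‖_{B^{1,log}}/‖f‖_{B¹} such that ‖f − F‖_{H¹(Ω)} ≤ (4π²/√m)·C₂·|Ω|^{1/2}·‖f‖_{B¹}. -/

import Mathlib

open MeasureTheory Real Filter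

noncomputable section

/-- The ℓ¹ norm on `ℝ^d`. -/
def l1 {d : ℕ} (ξ : Fin d → ℝ) : ℝ := ∑ i, |ξ i|

/-- The Fourier transform `f̂(ξ) = ∫ f(x) e^{-2πi ξ·x} dx`. -/
def fhat {d : ℕ} (f : (Fin d → ℝ) → ℂ) (ξ : Fin d → ℝ) : ℂ :=
  ∫ x : Fin d → ℝ,
    Complex.exp (-(2 * (Real.pi : ℂ) * Complex.I * ((∑ i, ξ i * x i : ℝ) : ℂ))) * f x

/-- Fourier transform of a real-valued function. -/
def fhatR {d : ℕ} (f : (Fin d → ℝ) → ℝ) : (Fin d → ℝ) → ℂ :=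
  fhat (fun x => (f x : ℂ))

/-- log-Barron norm `∫ log₂(2+‖ξ‖₁)|g(ξ)| dξ` of a frequency-side function `g`. -/
def logBarron {d : ℕ} (g : (Fin d → ℝ) → ℂ) : ℝ :=
  ∫ ξ : Fin d → ℝ, Real.logb 2 (2 + l1 ξ) * ‖g ξ‖

/-- Barron norm of order 0 : `∫ (1 + ‖ξ‖₁⁰)|g(ξ)| dξ = 2∫|g(ξ)|dξ`. -/
def B0 {d : ℕ} (g : (Fin d → ℝ) → ℂ) : ℝ := 2 * ∫ ξ : Fin d → ℝ, ‖g ξ‖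

/-- Barron norm of order 1 : `∫ (1 + ‖ξ‖₁)|g(ξ)| dξ`. -/
def B1 {d : ℕ} (g : (Fin d → ℝ) → ℂ) : ℝ := ∫ ξ : Fin d → ℝ, (1 + l1 ξ) * ‖g ξ‖

/-- first-order log-Barron norm `∫ (1+‖ξ‖₁) log₂(2+‖ξ‖₁)|g(ξ)| dξ`. -/
def B1log {d : ℕ} (g : (Fin d → ℝ) → ℂ) : ℝ :=
  ∫ ξ : Fin d → ℝ, (1 + l1 ξ) * Real.logb 2 (2 + l1 ξ) * ‖g ξ‖

/-- One hidden ReLU layer `z ↦ ReLU(Wz+b)`. -/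
def reluLayer {N : ℕ} (W : Matrix (Fin N) (Fin N) ℝ) (b : Fin N → ℝ) (z : Fin N → ℝ) :
    Fin N → ℝ :=
  fun i => max 0 (W.mulVec z i + b i)

/-- Iterate `k` hidden layers. -/
def hiddenIter {N : ℕ} (W : ℕ → Matrix (Fin N) (Fin N) ℝ) (b : ℕ → Fin N → ℝ) :
    ℕ → (Fin N → ℝ) → (Fin N → ℝ)
  | 0, z => z
  | k + 1, z => reluLayer (W k) (b k) (hiddenIter W b k z)

/-- `F : ℝ^d → ℝ` is a ReLU network of width `N` and depth `L`:
`F(x) = W_L z_{L-1}`, `z₀ = x`, `z_l = ReLU(W_l z_{l-1} + b_l)` for `1 ≤ l ≤ L-1`. -/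
def IsReLUNet (d N L : ℕ) (F : (Fin d → ℝ) → ℝ) : Prop :=
  ∃ (W₁ : Matrix (Fin N) (Fin d) ℝ) (b₁ : Fin N → ℝ)
    (W : ℕ → Matrix (Fin N) (Fin N) ℝ) (b : ℕ → Fin N → ℝ) (Wout : Fin N → ℝ),
    ∀ x, F x = ∑ i, Wout i *
      hiddenIter W b (L - 2) (fun j => max 0 (W₁.mulVec x j + b₁ j)) i

/-- `v` is the `j`-th weak partial derivative of `u` on `Ω`. -/
def HasWeakPartial {d : ℕ} (Ω : Set (Fin d → ℝ)) (u : (Fin d → ℝ) → ℝ) (j : Fin d)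
    (v : (Fin d → ℝ) → ℝ) : Prop :=
  ∀ φ : (Fin d → ℝ) → ℝ, ContDiff ℝ (⊤ : ℕ∞) φ → HasCompactSupport φ → tsupport φ ⊆ interior Ω →
    ∫ x in Ω, u x * fderiv ℝ φ x (Pi.single j 1) = - ∫ x in Ω, v x * φ x

/-- Euclidean diameter of a set in `ℝ^d`. -/
def eucDiam {d : ℕ} (Ω : Set (Fin d → ℝ)) : ℝ :=
  sSup {r : ℝ | ∃ x ∈ Ω, ∃ y ∈ Ω, r = Real.sqrt (∑ i, (x i - y i) ^ 2)}


open scoped FourierTransform in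
theorem ae_inversion {V : Type*} [NormedAddCommGroup V] [InnerProductSpace ℝ V]
    [FiniteDimensional ℝ V] [MeasurableSpace V] [BorelSpace V] (f : V → ℂ)
    (hf : Integrable f) (hf' : Integrable (𝓕 f)) : ∀ᵐ x, f x = 𝓕⁻ (𝓕 f) x := by
  have hcont : Continuous (𝓕⁻ (𝓕 f)) := by
    have := VectorFourier.fourierIntegral_continuous (μ := volume) (L := -innerₗ V)
      Real.continuous_fourierChar (by simp only [LinearMap.neg_apply, innerₗ_apply_apply]; fun_prop) hf'
    exact this
  refine ae_eq_of_integral_contDiff_smul_eq hf.locallyIntegrable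
    hcont.locallyIntegrable ?_
  intro g hg hgs
  let φ : SchwartzMap V ℂ := HasCompactSupport.toSchwartzMap (f := fun x => (g x : ℂ))
    (hgs.comp_left (g := fun t : ℝ => (t : ℂ)) (by simp)) (Complex.ofRealCLM.contDiff.comp hg)
  have hφ : ∀ x, φ x = (g x : ℂ) := fun x => rfl
  let ψ : SchwartzMap V ℂ := 𝓕⁻ φ
  have hψ : 𝓕 ψ = φ := FourierTransform.fourier_fourierInv_eq φ
  have e1 : ∫ x, (𝓕 (ψ : V → ℂ) x) • f x = ∫ x, ψ x • 𝓕 f x := by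
    have := VectorFourier.integral_fourierIntegral_smul_eq_flip (μ := volume) (ν := volume)
      (L := innerₗ V) Real.continuous_fourierChar
      (by simpa using (continuous_inner (𝕜 := ℝ) (E := V))) ψ.integrable hf
    rw [flip_innerₗ] at this
    exact this
  have e2 : ∫ x, (𝓕⁻ (φ : V → ℂ) x) • 𝓕 f x = ∫ x, φ x • 𝓕⁻ (𝓕 f) x := by
    have := VectorFourier.integral_fourierIntegral_smul_eq_flip (μ := volume) (ν := volume)
      (L := -innerₗ V) Real.continuous_fourierChar
      (by simp only [LinearMap.neg_apply, innerₗ_apply_apply]; fun_prop) φ.integrable hf'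
    rw [show (-innerₗ V).flip = -innerₗ V by ext; simp [real_inner_comm]] at this
    exact this
  rw [← SchwartzMap.fourier_coe, hψ] at e1
  rw [← SchwartzMap.fourierInv_coe] at e2
  have := e1.trans e2
  simpa [hφ] using this

open scoped FourierTransform in
theorem fhatR_facts {d : ℕ} (f : (Fin d → ℝ) → ℝ) (hf1 : Integrable (fhatR f))
    (hB1 : 0 < B1 (fhatR f)) :
    Continuous (fhatR f) ∧ AEStronglyMeasurable f ∧
    ∀ᵐ x, f x = ∫ ξ, ‖fhatR f ξ‖ * Real.cos (2 * π * (∑ i, ξ i * x i) + (fhatR f ξ).arg) := by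
  have hfi : Integrable (fun x => (f x : ℂ)) := by
    by_contra h
    have h0 : ∀ ξ, fhatR f ξ = 0 := by
      intro ξ
      unfold fhatR fhat
      apply integral_undef
      intro h'
      apply h
      have : Integrable (fun x => Complex.exp ((2 * (Real.pi : ℂ) * Complex.I * ((∑ i, ξ i * x i : ℝ) : ℂ))) * 
        (Complex.exp (-(2 * (Real.pi : ℂ) * Complex.I * ((∑ i, ξ i * x i : ℝ) : ℂ))) * (f x : ℂ))) := by
        refine h'.bdd_mul (c := 1) (Continuous.aestronglyMeasurable (by fun_prop)) ?_
        filter_upwards with x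
        rw [show (2 * (Real.pi : ℂ) * Complex.I * ((∑ i, ξ i * x i : ℝ) : ℂ)) = ((2 * π * ∑ i, ξ i * x i : ℝ) : ℂ) * Complex.I by push_cast; ring]
        rw [Complex.norm_exp_ofReal_mul_I]
      refine this.congr ?_
      filter_upwards with x
      rw [← mul_assoc, ← Complex.exp_add]; simp
    simp [B1, h0] at hB1
  let e := PiLp.volume_preserving_ofLp (Fin d)
  let eT := PiLp.volume_preserving_toLp (Fin d)
  have me : MeasurableEmbedding (@WithLp.ofLp 2 (Fin d → ℝ)) := (MeasurableEquiv.toLp 2 (Fin d → ℝ)).symm.measurableEmbedding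
  have meT : MeasurableEmbedding (@WithLp.toLp 2 (Fin d → ℝ)) := (MeasurableEquiv.toLp 2 (Fin d → ℝ)).measurableEmbedding
  let fe : EuclideanSpace ℝ (Fin d) → ℂ := fun x => (f x.ofLp : ℂ)
  have hfe : Integrable fe := (e.integrable_comp_emb me).2 hfi
  have hF : ∀ ξ : Fin d → ℝ, 𝓕 fe (WithLp.toLp 2 ξ) = fhatR f ξ := by
    intro ξ
    rw [Real.fourier_eq', ← eT.integral_comp meT]
    unfold fhatR fhat
    congr 1
    ext x
    simp only [fe, smul_eq_mul, PiLp.inner_apply]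
    congr 2
    push_cast
    simp
    ring
  have hF' : 𝓕 fe = fhatR f ∘ WithLp.ofLp := by
    ext ξ
    exact hF ξ.ofLp
  have hcF : Continuous (𝓕 fe) := 
    VectorFourier.fourierIntegral_continuous 
      Real.continuous_fourierChar (by simpa using (continuous_inner (𝕜 := ℝ) (E := EuclideanSpace ℝ (Fin d)))) hfe
  have hFi : Integrable (𝓕 fe) := by
    rw [hF']
    exact (e.integrable_comp_emb me).2 hf1
  refine ⟨?_, ?_, ?_⟩
  · have : fhatR f = 𝓕 fe ∘ WithLp.toLp 2 := by ext ξ; exact (hF ξ).symm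
    rw [this]
    exact hcF.comp (by fun_prop)
  · have := Complex.continuous_re.comp_aestronglyMeasurable hfi.aestronglyMeasurable
    simpa using this
  · have h1 := ae_inversion fe hfe hFi
    have h2 := eT.quasiMeasurePreserving.ae h1
    filter_upwards [h2] with x hx
    rw [Real.fourierInv_eq', ← eT.integral_comp meT] at hx
    have hx' := congrArg Complex.re hx
    have hint : Integrable (fun ξ : Fin d → ℝ => Complex.exp ((↑(2 * π * ∑ i, ξ i * x i) * Complex.I)) * fhatR f ξ) := by
      refine hf1.bdd_mul (c := 1) (Continuous.aestronglyMeasurable (by fun_prop)) ?_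
      filter_upwards with ξ
      rw [Complex.norm_exp_ofReal_mul_I]
    have : ∀ ξ : Fin d → ℝ, Complex.exp ((↑(2 * π * inner ℝ (WithLp.toLp 2 ξ) (WithLp.toLp 2 x)) * Complex.I)) • 𝓕 fe (WithLp.toLp 2 ξ) = Complex.exp ((↑(2 * π * ∑ i, ξ i * x i) * Complex.I)) * fhatR f ξ := by
      intro ξ
      rw [hF, smul_eq_mul]
      simp [PiLp.inner_apply, mul_comm]
    simp_rw [this] at hx'
    have hre := integral_re hint
    simp only [RCLike.re_to_complex] at hre
    rw [← hre] at hx'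
    simp only [fe, Complex.ofReal_re] at hx'
    rw [hx']
    congr 1
    ext ξ
    conv_lhs => rw [← Complex.norm_mul_exp_arg_mul_I (fhatR f ξ)]
    rw [mul_left_comm, ← Complex.exp_add, ← add_mul, ← Complex.ofReal_add, Complex.re_ofReal_mul,
      Complex.exp_ofReal_mul_I_re]

/-- triangle wave of period 1 -/
def tri (t : ℝ) : ℝ := 2 * ‖(t : UnitAddCircle)‖

theorem tri_eq (t : ℝ) : tri t = 2 * |t - round t| := by
  unfold tri; rw [UnitAddCircle.norm_eq]

theorem tri_lip : LipschitzWith 2 tri := by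
  apply LipschitzWith.of_dist_le_mul
  intro a b
  simp only [Real.dist_eq, tri, NNReal.coe_ofNat]
  rw [← mul_sub, abs_mul, abs_of_pos (by norm_num : (0:ℝ) < 2)]
  refine mul_le_mul_of_nonneg_left ?_ (by norm_num)
  refine (abs_norm_sub_norm_le (a : UnitAddCircle) (b : UnitAddCircle)).trans ?_
  rw [← AddCircle.coe_sub, UnitAddCircle.norm_eq]
  simpa using round_le (a - b) 0

theorem tri_cont : Continuous tri := tri_lip.continuous

theorem tri_periodic : Function.Periodic tri 1 := by
  intro t; unfold tri; simp

theorem tri_nonneg (t : ℝ) : 0 ≤ tri t := by unfold tri; positivity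

theorem tri_le_one (t : ℝ) : tri t ≤ 1 := by
  rw [tri_eq]; have := abs_sub_round t; linarith

theorem tri_of_le {t : ℝ} (h0 : 0 ≤ t) (h1 : t ≤ 1/2) : tri t = 2 * t := by
  unfold tri
  rw [(AddCircle.norm_coe_eq_abs_iff (p := 1) one_ne_zero).2 (by rw [abs_of_nonneg h0]; simpa using h1), abs_of_nonneg h0]

theorem tri_neg (t : ℝ) : tri (-t) = tri t := by unfold tri; simp

theorem tri_of_ge {t : ℝ} (h0 : 1/2 ≤ t) (h1 : t ≤ 1) : tri t = 2 - 2 * t := by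
  have : tri t = tri (1 - t) := by
    rw [← tri_neg t, ← tri_periodic (-t)]; ring_nf
  rw [this, tri_of_le (by linarith) (by linarith)]; ring

theorem tri_int (t : ℝ) (n : ℤ) : tri (t - n) = tri t := by
  have := tri_periodic.sub_int_mul_eq n (x := t)
  simpa using this

theorem tri_tri (t : ℝ) : tri (tri t) = tri (2 * t) := by
  rw [tri_eq t]
  have : tri (2 * t) = tri (2 * (t - round t)) := by
    rw [← tri_int (2 * t) (2 * round t)]; push_cast; ring_nf
  rw [this]
  rcases abs_choice (t - round t) with h | h <;> rw [h]
  rw [mul_neg, tri_neg]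

theorem tri_iter (n : ℕ) (u : ℝ) : tri^[n+1] u = tri (2 ^ n * u) := by
  induction n generalizing u with
  | zero => simp
  | succ n ih =>
    rw [Function.iterate_succ_apply', ih, tri_tri]; ring_nf

theorem tri_relu {u : ℝ} (h0 : 0 ≤ u) (h1 : u ≤ 1) :
    2 * max 0 u - 4 * max 0 (u - 1/2) = tri u := by
  rw [max_eq_right h0]
  rcases le_total u (1/2) with h | h
  · rw [max_eq_left (by linarith), tri_of_le h0 h]; ring
  · rw [max_eq_right (by linarith), tri_of_ge h h1]; ring

theorem tri_cos_int (t θ : ℝ) :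
    ∫ s in Set.Ioc (0:ℝ) 1, Real.cos (2 * π * s + θ) * tri (t - s) = 
      -(2 / π ^ 2) * Real.cos (2 * π * t + θ) := by
  rw [← intervalIntegral.integral_of_le (by norm_num)]
  have hc : Continuous (fun u => Real.cos (2 * π * (t - u) + θ) * tri u) := by
    have := tri_cont; fun_prop
  have e1 : ∫ s in (0:ℝ)..1, Real.cos (2 * π * s + θ) * tri (t - s) = 
      ∫ u in (0:ℝ)..1, Real.cos (2 * π * (t - u) + θ) * tri u := by
    have h1 := intervalIntegral.integral_comp_sub_left (a := 0) (b := 1) (fun u => Real.cos (2 * π * (t - u) + θ) * tri u) t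
    simp only [sub_sub_cancel] at h1
    rw [h1]
    have hp : Function.Periodic (fun u => Real.cos (2 * π * (t - u) + θ) * tri u) 1 := by
      intro u
      simp only
      rw [tri_periodic u, show 2 * π * (t - (u + 1)) + θ = 2 * π * (t - u) + θ - 2 * π by ring, Real.cos_sub_two_pi]
    have := hp.intervalIntegral_add_eq (t - 1) 0
    simpa using this
  rw [e1, ← intervalIntegral.integral_add_adjacent_intervals (b := 1/2) (hc.intervalIntegrable _ _) (hc.intervalIntegrable _ _)]
  have hpi := Real.pi_ne_zero
  have e2 : ∫ u in (0:ℝ)..(1/2), Real.cos (2 * π * (t - u) + θ) * tri u = 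
      ∫ u in (0:ℝ)..(1/2), Real.cos (2 * π * (t - u) + θ) * (2 * u) := by
    apply intervalIntegral.integral_congr
    intro u hu
    rw [Set.uIcc_of_le (by norm_num)] at hu
    simp only
    rw [tri_of_le hu.1 hu.2]
  have e3 : ∫ u in (1/2:ℝ)..1, Real.cos (2 * π * (t - u) + θ) * tri u = 
      ∫ u in (1/2:ℝ)..1, Real.cos (2 * π * (t - u) + θ) * (2 - 2 * u) := by
    apply intervalIntegral.integral_congr
    intro u hu
    rw [Set.uIcc_of_le (by norm_num)] at hu
    simp only
    rw [tri_of_ge hu.1 hu.2]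
  have gen : ∀ a b x y : ℝ, ∫ u in x..y, Real.cos (2 * π * (t - u) + θ) * (a + b * u) = 
      (-(a + b * y) * Real.sin (2 * π * (t - y) + θ) / (2 * π) + b * Real.cos (2 * π * (t - y) + θ) / (2 * π) ^ 2)
      - (-(a + b * x) * Real.sin (2 * π * (t - x) + θ) / (2 * π) + b * Real.cos (2 * π * (t - x) + θ) / (2 * π) ^ 2) := by
    intro a b x y
    apply intervalIntegral.integral_eq_sub_of_hasDerivAt (f := fun u => -(a + b * u) * Real.sin (2 * π * (t - u) + θ) / (2 * π) + b * Real.cos (2 * π * (t - u) + θ) / (2 * π) ^ 2)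
    · intro u _
      have l : HasDerivAt (fun u => 2 * π * (t - u) + θ) (2 * π * (-1)) u := by
        have := (((hasDerivAt_id u).const_sub t).const_mul (2 * π)).add_const θ
        simpa using this
      have l2 : HasDerivAt (fun u => -(a + b * u)) (-b) u := by
        have := (((hasDerivAt_id u).const_mul b).const_add a).neg
        simp only [mul_one] at this
        exact this
      have := ((l2.mul l.sin).div_const (2 * π)).add ((l.cos.const_mul b).div_const ((2 * π) ^ 2))
      refine HasDerivAt.congr_deriv this ?_
      field_simp
      ring
    · apply Continuous.intervalIntegrable; fun_prop
  rw [e2, e3]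
  have g1 := gen 0 2 0 (1/2)
  have g2 := gen 2 (-2) (1/2) 1
  simp only [zero_add] at g1
  simp only [neg_mul, ← sub_eq_add_neg (2:ℝ)] at g2
  rw [g1, g2]
  rw [show 2 * π * (t - 1/2) + θ = 2 * π * t + θ - π by ring, show 2 * π * (t - 1) + θ = 2 * π * t + θ - 2 * π by ring]
  simp only [Real.cos_sub_two_pi, Real.sin_sub_two_pi, Real.cos_sub_pi, Real.sin_sub_pi, sub_zero]
  field_simp
  ring

theorem hiddenIter_congr {N : ℕ} (W W' : ℕ → Matrix (Fin N) (Fin N) ℝ) (b b' : ℕ → Fin N → ℝ)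
    (k : ℕ) (h : ∀ j < k, W j = W' j) (h' : ∀ j < k, b j = b' j) (z : Fin N → ℝ) :
    hiddenIter W b k z = hiddenIter W' b' k z := by
  induction k with
  | zero => rfl
  | succ k ih =>
    simp only [hiddenIter]
    rw [ih (fun j hj => h j (by omega)) (fun j hj => h' j (by omega)), h k (by omega), h' k (by omega)]

/-- after `k` iterated layers the state on `Ω` is `(x + τ, w x)`. -/
def ReachOn {d : ℕ} (Ω : Set (Fin d → ℝ)) (τ : Fin d → ℝ) (k : ℕ)
    (w : (Fin d → ℝ) → Fin 4 → ℝ) : Prop :=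
  ∃ (W₁ : Matrix (Fin (d + 4)) (Fin d) ℝ) (b₁ : Fin (d + 4) → ℝ)
    (W : ℕ → Matrix (Fin (d + 4)) (Fin (d + 4)) ℝ) (b : ℕ → Fin (d + 4) → ℝ),
    ∀ x ∈ Ω, hiddenIter W b k (fun j => max 0 (W₁.mulVec x j + b₁ j)) =
      Sum.elim (x + τ) (w x) ∘ finSumFinEquiv.symm

theorem ReachOn.init {d : ℕ} (Ω : Set (Fin d → ℝ)) (τ : Fin d → ℝ)
    (hτ : ∀ x ∈ Ω, ∀ i, 0 ≤ x i + τ i) : ReachOn Ω τ 0 (fun _ => 0) := by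
  refine ⟨(Matrix.fromRows (1 : Matrix (Fin d) (Fin d) ℝ) (0 : Matrix (Fin 4) (Fin d) ℝ)).submatrix
    finSumFinEquiv.symm id, Sum.elim τ 0 ∘ finSumFinEquiv.symm, fun _ => 0, fun _ => 0, ?_⟩
  intro x hx
  simp only [hiddenIter]
  ext j
  obtain ⟨j, rfl⟩ := finSumFinEquiv.surjective j
  have e : (Matrix.submatrix (Matrix.fromRows (1 : Matrix (Fin d) (Fin d) ℝ) (0 : Matrix (Fin 4) (Fin d) ℝ))
    finSumFinEquiv.symm id).mulVec x (finSumFinEquiv j) = (Matrix.fromRows (1 : Matrix (Fin d) (Fin d) ℝ) (0 : Matrix (Fin 4) (Fin d) ℝ)).mulVec x j := by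
    simp [Matrix.mulVec, dotProduct]
  rw [e, Matrix.fromRows_mulVec]
  rcases j with j | j
  · simp [hτ x hx j]
  · simp

theorem ReachOn.step {d : ℕ} {Ω : Set (Fin d → ℝ)} {τ : Fin d → ℝ}
    (hτ : ∀ x ∈ Ω, ∀ i, 0 ≤ x i + τ i) {k : ℕ} {w : (Fin d → ℝ) → Fin 4 → ℝ}
    (h : ReachOn Ω τ k w) (C : Matrix (Fin 4) (Fin d) ℝ) (D : Matrix (Fin 4) (Fin 4) ℝ)
    (β : Fin 4 → ℝ) (w' : (Fin d → ℝ) → Fin 4 → ℝ)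
    (hw : ∀ x ∈ Ω, ∀ i, max 0 (C.mulVec (x + τ) i + D.mulVec (w x) i + β i) = w' x i) :
    ReachOn Ω τ (k + 1) w' := by
  obtain ⟨W₁, b₁, W, b, H⟩ := h
  let Wn : Matrix (Fin (d + 4)) (Fin (d + 4)) ℝ :=
    (Matrix.fromBlocks (1 : Matrix (Fin d) (Fin d) ℝ) 0 C D).submatrix finSumFinEquiv.symm finSumFinEquiv.symm
  refine ⟨W₁, b₁, Function.update W k Wn, Function.update b k (Sum.elim 0 β ∘ finSumFinEquiv.symm), ?_⟩
  intro x hx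
  simp only [hiddenIter, Function.update_self]
  rw [hiddenIter_congr _ W _ b k
    (fun j hj => by rw [Function.update_of_ne (by omega)])
    (fun j hj => by rw [Function.update_of_ne (by omega)]), H x hx]
  ext j
  obtain ⟨j, rfl⟩ := finSumFinEquiv.surjective j
  unfold reluLayer
  have e : Wn.mulVec (Sum.elim (x + τ) (w x) ∘ finSumFinEquiv.symm) (finSumFinEquiv j) =
      (Matrix.fromBlocks (1 : Matrix (Fin d) (Fin d) ℝ) 0 C D).mulVec (Sum.elim (x + τ) (w x)) j := by
    simp only [Wn, Matrix.submatrix_mulVec_equiv]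
    simp [Function.comp_assoc]
  rw [e, Matrix.fromBlocks_mulVec]
  rcases j with j | j
  · simp [hτ x hx j]
  · simpa using hw x hx j

theorem ReachOn.out {d : ℕ} {Ω : Set (Fin d → ℝ)} {τ : Fin d → ℝ}
    {k : ℕ} {P Q : (Fin d → ℝ) → ℝ}
    (h : ReachOn Ω τ k (fun x => ![0, 0, P x, Q x])) :
    ∃ F, IsReLUNet d (d + 4) (k + 2) F ∧ ∀ x ∈ Ω, F x = P x - Q x := by
  obtain ⟨W₁, b₁, W, b, H⟩ := h
  let wo : Fin (d + 4) → ℝ := Sum.elim 0 ![0, 0, 1, -1] ∘ finSumFinEquiv.symm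
  refine ⟨fun x => ∑ i, wo i * hiddenIter W b k (fun j => max 0 (W₁.mulVec x j + b₁ j)) i,
    ⟨W₁, b₁, W, b, wo, fun x => rfl⟩, ?_⟩
  intro x hx
  simp only [H x hx]
  rw [← finSumFinEquiv.sum_comp]
  simp [wo, Fin.sum_univ_four]
  ring

theorem ReachOn.sample {d : ℕ} {Ω : Set (Fin d → ℝ)} {τ : Fin d → ℝ}
    (hτ : ∀ x ∈ Ω, ∀ i, 0 ≤ x i + τ i) {k : ℕ} {P Q : (Fin d → ℝ) → ℝ}
    (hP : ∀ x ∈ Ω, 0 ≤ P x) (hQ : ∀ x ∈ Ω, 0 ≤ Q x)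
    (h : ReachOn Ω τ k (fun x => ![0, 0, P x, Q x]))
    (c : ℝ) (ξ : Fin d → ℝ) (s : ℝ) (N : ℤ) (n : ℕ)
    (hu : ∀ x ∈ Ω, 0 ≤ ∑ i, ξ i * x i - s - N ∧ ∑ i, ξ i * x i - s - N ≤ 2 ^ n) :
    ReachOn Ω τ (k + (n + 2)) (fun x => ![0, 0, P x + max c 0 * tri (∑ i, ξ i * x i - s),
      Q x + max (-c) 0 * tri (∑ i, ξ i * x i - s)]) := by
  let u : (Fin d → ℝ) → ℝ := fun x => (∑ i, ξ i * x i - s - N) / 2 ^ n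
  have hu0 : ∀ x ∈ Ω, 0 ≤ u x := fun x hx => div_nonneg (hu x hx).1 (by positivity)
  have hu1 : ∀ x ∈ Ω, u x ≤ 1 := fun x hx => (div_le_one (by positivity)).2 (hu x hx).2
  have it0 : ∀ j, ∀ x ∈ Ω, 0 ≤ tri^[j] (u x) := by
    intro j x hx
    rcases j with _ | j
    · exact hu0 x hx
    · rw [Function.iterate_succ_apply']; exact tri_nonneg _
  have it1 : ∀ j, ∀ x ∈ Ω, tri^[j] (u x) ≤ 1 := by
    intro j x hx
    rcases j with _ | j
    · exact hu1 x hx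
    · rw [Function.iterate_succ_apply']; exact tri_le_one _
  have key : ∀ j, ReachOn Ω τ (k + (j + 1)) (fun x => ![max 0 (tri^[j] (u x)),
      max 0 (tri^[j] (u x) - 1/2), P x, Q x]) := by
    intro j
    induction j with
    | zero =>
      refine h.step hτ (Matrix.of ![fun i => ξ i / 2 ^ n, fun i => ξ i / 2 ^ n, 0, 0])
        !![0,0,0,0;0,0,0,0;0,0,1,0;0,0,0,1]
        ![(-(∑ i, ξ i * τ i) - s - N) / 2 ^ n, (-(∑ i, ξ i * τ i) - s - N) / 2 ^ n - 1/2, 0, 0] _ ?_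
      intro x hx i
      have e : ∑ i, ξ i / 2 ^ n * (x i + τ i) + (-(∑ i, ξ i * τ i) - s - N) / 2 ^ n = u x := by
        have : ∑ i, ξ i / 2 ^ n * (x i + τ i) = (∑ i, ξ i * x i + ∑ i, ξ i * τ i) / 2 ^ n := by
          rw [← Finset.sum_add_distrib, Finset.sum_div]
          refine Finset.sum_congr rfl fun i _ => ?_
          ring
        rw [this]; simp only [u]; ring
      have hp := hP x hx
      have hq := hQ x hx
      fin_cases i
      · simp [Matrix.mulVec, dotProduct, Fin.sum_univ_four]
        rw [e]
      · simp [Matrix.mulVec, dotProduct, Fin.sum_univ_four]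
        rw [← e]; congr 1; ring
      · simp [Matrix.mulVec, dotProduct, Fin.sum_univ_four, hp]
      · simp [Matrix.mulVec, dotProduct, Fin.sum_univ_four, hq]
    | succ j ih =>
      refine ih.step hτ 0
        !![2,-4,0,0;2,-4,0,0;0,0,1,0;0,0,0,1] ![0, -1/2, 0, 0] _ ?_
      intro x hx i
      have e := tri_relu (it0 j x hx) (it1 j x hx)
      rw [← Function.iterate_succ_apply' tri] at e
      have hp := hP x hx
      have hq := hQ x hx
      rw [← e]
      fin_cases i
      · simp [Matrix.mulVec, dotProduct, Fin.sum_univ_four]; ring_nf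
      · simp [Matrix.mulVec, dotProduct, Fin.sum_univ_four]; ring_nf
      · simp [Matrix.mulVec, dotProduct, Fin.sum_univ_four, hp]
      · simp [Matrix.mulVec, dotProduct, Fin.sum_univ_four, hq]
  refine (key n).step hτ 0 !![0,0,0,0;0,0,0,0;2 * max c 0,-4 * max c 0,1,0;2 * max (-c) 0,-4 * max (-c) 0,0,1] 0 _ ?_
  intro x hx i
  have e := tri_relu (it0 n x hx) (it1 n x hx)
  rw [← Function.iterate_succ_apply' tri, tri_iter] at e
  have e2 : (2:ℝ) ^ n * u x = (∑ i, ξ i * x i - s) - N := by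
    simp only [u]; field_simp
  rw [e2, tri_int] at e
  have hp := hP x hx
  have hq := hQ x hx
  have ht := tri_nonneg (∑ i, ξ i * x i - s)
  have hc1 : 0 ≤ max c 0 := le_max_right _ _
  have hc2 : 0 ≤ max (-c) 0 := le_max_right _ _
  fin_cases i
  · simp [Matrix.mulVec, dotProduct, Fin.sum_univ_four]
  · simp [Matrix.mulVec, dotProduct, Fin.sum_univ_four]
  · rw [max_eq_right]
    · rw [← e]; simp [Matrix.mulVec, dotProduct, Fin.sum_univ_four]; ring
    · have : 0 ≤ P x + max c 0 * tri (∑ i, ξ i * x i - s) := by positivity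
      rw [← e] at this
      refine this.trans_eq ?_
      simp [Matrix.mulVec, dotProduct, Fin.sum_univ_four]; ring
  · rw [max_eq_right]
    · rw [← e]; simp [Matrix.mulVec, dotProduct, Fin.sum_univ_four]; ring
    · have : 0 ≤ Q x + max (-c) 0 * tri (∑ i, ξ i * x i - s) := by positivity
      rw [← e] at this
      refine this.trans_eq ?_
      simp [Matrix.mulVec, dotProduct, Fin.sum_univ_four]; ring

theorem l1_nonneg {d : ℕ} (ξ : Fin d → ℝ) : 0 ≤ l1 ξ := Finset.sum_nonneg fun _ _ => abs_nonneg _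

theorem net_build {d : ℕ} (Ω : Set (Fin d → ℝ)) (x0 : Fin d → ℝ) (C : ℝ) (hC : 1 ≤ C)
    (hd : ∀ x ∈ Ω, ∀ i, |x i - x0 i| ≤ C)
    (c : ℕ → ℝ) (ξ : ℕ → Fin d → ℝ) (s : ℕ → ℝ) (m : ℕ) :
    ∃ (L : ℕ) (F : (Fin d → ℝ) → ℝ), IsReLUNet d (d + 4) L F ∧
      (L : ℝ) ≤ 2 + ∑ k ∈ Finset.range m, (Real.logb 2 (2 + l1 (ξ k)) + 4 + Real.logb 2 C) ∧
      ∀ x ∈ Ω, F x = ∑ k ∈ Finset.range m, c k * tri (∑ i, ξ k i * x i - s k) := by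
  let τ : Fin d → ℝ := fun i => C - x0 i
  have hτ : ∀ x ∈ Ω, ∀ i, 0 ≤ x i + τ i := by
    intro x hx i
    have := abs_le.1 (hd x hx i)
    simp only [τ]; linarith [this.1]
  suffices H : ∃ (K : ℕ) (P Q : (Fin d → ℝ) → ℝ), (∀ x ∈ Ω, 0 ≤ P x) ∧ (∀ x ∈ Ω, 0 ≤ Q x) ∧
      ReachOn Ω τ K (fun x => ![0, 0, P x, Q x]) ∧
      (K : ℝ) ≤ ∑ k ∈ Finset.range m, (Real.logb 2 (2 + l1 (ξ k)) + 4 + Real.logb 2 C) ∧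
      ∀ x ∈ Ω, P x - Q x = ∑ k ∈ Finset.range m, c k * tri (∑ i, ξ k i * x i - s k) by
    obtain ⟨K, P, Q, hP, hQ, hR, hK, hs⟩ := H
    obtain ⟨F, hF, hF'⟩ := hR.out
    refine ⟨K + 2, F, hF, by push_cast; linarith, fun x hx => (hF' x hx).trans (hs x hx)⟩
  induction m with
  | zero =>
    refine ⟨0, fun _ => 0, fun _ => 0, by simp, by simp, ?_, by simp, by simp⟩
    convert ReachOn.init Ω τ hτ using 2
    ext i; fin_cases i <;> rfl
  | succ m ih =>
    obtain ⟨K, P, Q, hP, hQ, hR, hK, hs⟩ := ih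
    have hl := l1_nonneg (ξ m)
    have hR0 : 0 ≤ l1 (ξ m) * C := by positivity
    have hn0 := Nat.le_ceil (Real.logb 2 (2 * (l1 (ξ m) * C) + 1))
    have hn1 := Nat.ceil_lt_add_one (a := Real.logb 2 (2 * (l1 (ξ m) * C) + 1))
      (Real.logb_nonneg (by norm_num) (by linarith))
    set n := ⌈Real.logb 2 (2 * (l1 (ξ m) * C) + 1)⌉₊
    have hpow : 2 * (l1 (ξ m) * C) + 1 ≤ (2:ℝ) ^ n := by
      rw [Real.logb_le_iff_le_rpow (by norm_num) (by linarith)] at hn0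
      simpa using hn0
    have hnle : (n : ℝ) ≤ Real.logb 2 (2 + l1 (ξ m)) + 2 + Real.logb 2 C := by
      have : Real.logb 2 (2 * (l1 (ξ m) * C) + 1) ≤ Real.logb 2 (2 * ((2 + l1 (ξ m)) * C)) := by
        apply Real.logb_le_logb_of_le (by norm_num) (by linarith)
        nlinarith
      rw [Real.logb_mul (by norm_num) (by positivity), Real.logb_mul (by positivity) (by positivity),
        Real.logb_self_eq_one (by norm_num)] at this
      linarith
    have hdot : ∀ x ∈ Ω, |∑ i, ξ m i * x i - ∑ i, ξ m i * x0 i| ≤ l1 (ξ m) * C := by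
      intro x hx
      rw [← Finset.sum_sub_distrib]
      refine (Finset.abs_sum_le_sum_abs _ _).trans ?_
      unfold l1
      rw [Finset.sum_mul]
      refine Finset.sum_le_sum fun i _ => ?_
      rw [← mul_sub, abs_mul]
      exact mul_le_mul_of_nonneg_left (hd x hx i) (abs_nonneg _)
    have f0 := Int.floor_le (∑ i, ξ m i * x0 i - s m - l1 (ξ m) * C)
    have f1 := Int.lt_floor_add_one (∑ i, ξ m i * x0 i - s m - l1 (ξ m) * C)
    set N := ⌊∑ i, ξ m i * x0 i - s m - l1 (ξ m) * C⌋
    have := hR.sample hτ hP hQ (c m) (ξ m) (s m) N n (by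
      intro x hx
      have := abs_le.1 (hdot x hx)
      constructor <;> linarith [this.1, this.2])
    refine ⟨_, _, _, ?_, ?_, this, ?_, ?_⟩
    · intro x hx
      have := hP x hx
      have := tri_nonneg (∑ i, ξ m i * x i - s m)
      positivity
    · intro x hx
      have := hQ x hx
      have := tri_nonneg (∑ i, ξ m i * x i - s m)
      positivity
    · rw [Finset.sum_range_succ]; push_cast; linarith
    · intro x hx
      rw [Finset.sum_range_succ, ← hs x hx]
      have : max (c m) 0 - max (-c m) 0 = c m := by
        rcases le_total (c m) 0 with h | h
        · rw [max_eq_right h, max_eq_left (by linarith)]; ring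
        · rw [max_eq_left h, max_eq_right (by linarith)]; ring
      linear_combination this * tri (∑ i, ξ m i * x i - s m)

theorem int_of_bdd {α : Type*} [MeasurableSpace α] {μ : Measure α} [IsFiniteMeasure μ] {f : α → ℝ}
    (hf : Measurable f) (M : ℝ) (h : ∀ x, |f x| ≤ M) : Integrable f μ :=
  Integrable.of_bound hf.aestronglyMeasurable M (Eventually.of_forall h)

theorem maurey_one {S X : Type*} [MeasurableSpace S] [MeasurableSpace X]
    (μ : Measure S) [IsProbabilityMeasure μ] (ν : Measure X) [IsFiniteMeasure ν]
    (Z : S → X → ℝ) (hZ : Measurable (fun p : S × X => Z p.1 p.2)) (M : ℝ)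
    (hM : ∀ s x, |Z s x| ≤ M) (a : X → ℝ) (ha : Measurable a) (A : ℝ) (hA : ∀ x, |a x| ≤ A) :
    Integrable (fun s => ∫ x, (a x + Z s x - ∫ t, Z t x ∂μ) ^ 2 ∂ν) μ ∧
    ∫ s, ∫ x, (a x + Z s x - ∫ t, Z t x ∂μ) ^ 2 ∂ν ∂μ ≤
      ∫ x, a x ^ 2 ∂ν + ∫ s, ∫ x, Z s x ^ 2 ∂ν ∂μ := by
  have hg : Measurable (fun x => ∫ t, Z t x ∂μ) := by
    have : StronglyMeasurable (fun p : X × S => Z p.2 p.1) := (hZ.comp measurable_swap).stronglyMeasurable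
    exact this.integral_prod_right.measurable
  set g := fun x => ∫ t, Z t x ∂μ with hgdef
  have hgb : ∀ x, |g x| ≤ M := by
    intro x
    have := norm_integral_le_of_norm_le_const (μ := μ) (f := fun t => Z t x) (C := M) (Eventually.of_forall fun t => hM t x)
    simpa using this
  have hq : Measurable (fun p : S × X => (a p.2 + Z p.1 p.2 - g p.2) ^ 2) := by fun_prop
  have hqi : Integrable (fun p : S × X => (a p.2 + Z p.1 p.2 - g p.2) ^ 2) (μ.prod ν) := by
    refine int_of_bdd hq ((A + M + M) ^ 2) ?_
    intro p
    rw [abs_of_nonneg (sq_nonneg _), sq_le_sq]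
    refine le_trans ?_ (le_abs_self _)
    have := abs_le.1 (hA p.2); have := abs_le.1 (hM p.1 p.2); have := abs_le.1 (hgb p.2)
    rw [abs_le]; constructor <;> linarith
  have hzi : Integrable (fun p : S × X => (Z p.1 p.2) ^ 2) (μ.prod ν) := by
    refine int_of_bdd (by fun_prop) (M ^ 2) ?_
    intro p
    rw [abs_of_nonneg (sq_nonneg _), sq_le_sq]
    exact (hM _ _).trans (le_abs_self _)
  refine ⟨hqi.integral_prod_left, ?_⟩
  have s1 := integral_integral_swap (μ := μ) (ν := ν) (f := fun s x => (a x + Z s x - g x) ^ 2) hqi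
  have s2 := integral_integral_swap (μ := μ) (ν := ν) (f := fun s x => (Z s x) ^ 2) hzi
  have ai : Integrable (fun x => a x ^ 2) ν := by
    refine int_of_bdd (by fun_prop) (A ^ 2) ?_
    intro p
    rw [abs_of_nonneg (sq_nonneg _), sq_le_sq]
    exact (hA _).trans (le_abs_self _)
  have zi2 : Integrable (fun x => ∫ s, Z s x ^ 2 ∂μ) ν := hzi.integral_prod_right
  rw [show (∫ s, ∫ x, (a x + Z s x - g x) ^ 2 ∂ν ∂μ) = _ from s1, s2, ← integral_add ai zi2]
  refine integral_mono hqi.integral_prod_right (ai.add zi2) ?_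
  intro x
  simp only
  have mx : Measurable (fun s => Z s x) := hZ.comp (by fun_prop : Measurable fun s => (s, x))
  have i1 : Integrable (fun s => Z s x) μ := int_of_bdd mx M (fun s => hM s x)
  have i2 : Integrable (fun s => Z s x ^ 2) μ := by
    refine int_of_bdd (by fun_prop) (M ^ 2) ?_
    intro p
    rw [abs_of_nonneg (sq_nonneg _), sq_le_sq]
    exact (hM _ _).trans (le_abs_self _)
  have : ∫ s, (a x + Z s x - g x) ^ 2 ∂μ = (a x - g x) ^ 2 + 2 * (a x - g x) * g x + ∫ s, Z s x ^ 2 ∂μ := by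
    have e : ∀ s, (a x + Z s x - g x) ^ 2 = ((a x - g x) ^ 2 + 2 * (a x - g x) * Z s x) + Z s x ^ 2 := fun s => by ring
    simp_rw [e]
    have hh : Integrable (fun s => (a x - g x) ^ 2 + 2 * (a x - g x) * Z s x) μ := (integrable_const _).add (i1.const_mul _)
    rw [integral_add hh i2, integral_add (integrable_const _) (i1.const_mul _), integral_const_mul]
    simp [hgdef]
  rw [this]
  nlinarith [sq_nonneg (g x)]

theorem maurey {S X ι : Type*} [MeasurableSpace S] [MeasurableSpace X] [Fintype ι]
    (μ : Measure S) [IsProbabilityMeasure μ] (ν : Measure X) [IsFiniteMeasure ν]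
    (Z : ι → S → X → ℝ) (hZ : ∀ i, Measurable (fun p : S × X => Z i p.1 p.2)) (M : ℝ)
    (hM : ∀ i s x, |Z i s x| ≤ M) (V : ℝ) (hV : ∀ s, ∑ i, ∫ x, Z i s x ^ 2 ∂ν ≤ V)
    (cost : S → ℝ) (hcost : Integrable cost μ) (α β : ℝ) (hα : 0 ≤ α) (k : ℕ) :
    ∃ ω : ℕ → S, α * ∑ i, ∫ x, (∑ j ∈ Finset.range k, Z i (ω j) x - k * ∫ t, Z i t x ∂μ) ^ 2 ∂ν
      + β * ∑ j ∈ Finset.range k, cost (ω j) ≤ k * (α * V + β * ∫ s, cost s ∂μ) := by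
  induction k with
  | zero =>
    obtain ⟨s⟩ : Nonempty S := nonempty_of_isProbabilityMeasure μ
    exact ⟨fun _ => s, by simp⟩
  | succ k ih =>
    obtain ⟨ω, hω⟩ := ih
    let a : ι → X → ℝ := fun i x => ∑ j ∈ Finset.range k, Z i (ω j) x - k * ∫ t, Z i t x ∂μ
    have mx : ∀ i s, Measurable (fun x => Z i s x) := fun i s =>
      (hZ i).comp (by fun_prop : Measurable fun x => (s, x))
    have hg : ∀ i, Measurable (fun x => ∫ t, Z i t x ∂μ) := by
      intro i
      have : StronglyMeasurable (fun p : X × S => Z i p.2 p.1) := ((hZ i).comp measurable_swap).stronglyMeasurable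
      exact this.integral_prod_right.measurable
    have ha : ∀ i, Measurable (a i) := by
      intro i
      exact (Finset.measurable_sum _ fun j _ => mx i (ω j)).sub ((hg i).const_mul _)
    have hA : ∀ i x, |a i x| ≤ k * M + k * M := by
      intro i x
      refine (abs_sub _ _).trans (add_le_add ?_ ?_)
      · refine (Finset.abs_sum_le_sum_abs _ _).trans ?_
        refine (Finset.sum_le_sum fun j _ => hM i (ω j) x).trans ?_
        simp
      · rw [abs_mul, Nat.abs_cast]
        refine mul_le_mul_of_nonneg_left ?_ (by positivity)
        have := norm_integral_le_of_norm_le_const (μ := μ) (f := fun t => Z i t x) (C := M) (Eventually.of_forall fun t => hM i t x)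
        simpa using this
    have H := fun i => maurey_one μ ν (Z i) (hZ i) M (hM i) (a i) (ha i) _ (hA i)
    have I1 : Integrable (fun s => α * ∑ i, ∫ x, (a i x + Z i s x - ∫ t, Z i t x ∂μ) ^ 2 ∂ν) μ :=
      (integrable_finsetSum _ fun i _ => (H i).1).const_mul _
    obtain ⟨s, hs⟩ := exists_le_integral (I1.add (hcost.const_mul β))
    simp only [Pi.add_apply] at hs
    rw [integral_add I1 (hcost.const_mul β), integral_const_mul, integral_const_mul,
      integral_finsetSum _ (fun i _ => (H i).1)] at hs
    have hzi : ∀ i, Integrable (fun s => ∫ x, Z i s x ^ 2 ∂ν) μ := by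
      intro i
      have : Integrable (fun p : S × X => (Z i p.1 p.2) ^ 2) (μ.prod ν) := by
        refine int_of_bdd ((hZ i).pow_const 2) (M ^ 2) ?_
        intro p
        rw [abs_of_nonneg (sq_nonneg _), sq_le_sq]
        exact (hM _ _ _).trans (le_abs_self _)
      exact this.integral_prod_left
    have hsum : ∑ i, ∫ s, ∫ x, (a i x + Z i s x - ∫ t, Z i t x ∂μ) ^ 2 ∂ν ∂μ ≤
        ∑ i, ∫ x, a i x ^ 2 ∂ν + V := by
      refine (Finset.sum_le_sum fun i _ => (H i).2).trans ?_
      rw [Finset.sum_add_distrib]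
      gcongr
      rw [← integral_finsetSum _ (fun i _ => hzi i)]
      refine (integral_mono (integrable_finsetSum _ fun i _ => hzi i) (integrable_const V) hV).trans ?_
      simp
    have hsum' := mul_le_mul_of_nonneg_left hsum hα
    refine ⟨Function.update ω k s, ?_⟩
    have r : ∀ j ∈ Finset.range k, Function.update ω k s j = ω j := by
      intro j hj
      rw [Function.update_of_ne]
      have := Finset.mem_range.1 hj
      omega
    have e1 : ∀ i x, ∑ j ∈ Finset.range (k+1), Z i (Function.update ω k s j) x = 
        ∑ j ∈ Finset.range k, Z i (ω j) x + Z i s x := by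
      intro i x
      rw [Finset.sum_range_succ, Function.update_self]
      congr 1
      exact Finset.sum_congr rfl fun j hj => by rw [r j hj]
    have e2 : ∑ j ∈ Finset.range (k+1), cost (Function.update ω k s j) = 
        ∑ j ∈ Finset.range k, cost (ω j) + cost s := by
      rw [Finset.sum_range_succ, Function.update_self]
      congr 1
      exact Finset.sum_congr rfl fun j hj => by rw [r j hj]
    have e3 : ∀ i x, ∑ j ∈ Finset.range k, Z i (ω j) x + Z i s x - ((k + 1 : ℕ) : ℝ) * ∫ t, Z i t x ∂μ 
        = a i x + Z i s x - ∫ t, Z i t x ∂μ := by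
      intro i x; simp only [a]; push_cast; ring
    simp only [e1, e2, e3]
    push_cast
    simp only [a] at hs hsum' ⊢
    nlinarith

theorem meas_sec1 {S X : Type*} [MeasurableSpace S] [MeasurableSpace X]
    (Z : S → X → ℝ) (hZ : Measurable (fun p : S × X => Z p.1 p.2)) (x : X) :
    Measurable (fun s => Z s x) := hZ.comp (by fun_prop : Measurable fun s => (s, x))

theorem meas_sec2 {S X : Type*} [MeasurableSpace S] [MeasurableSpace X]
    (Z : S → X → ℝ) (hZ : Measurable (fun p : S × X => Z p.1 p.2)) (s : S) :
    Measurable (fun x => Z s x) := hZ.comp (by fun_prop : Measurable fun x => (s, x))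

theorem meas_mean {S X : Type*} [MeasurableSpace S] [MeasurableSpace X]
    (μ : Measure S) [IsProbabilityMeasure μ]
    (Z : S → X → ℝ) (hZ : Measurable (fun p : S × X => Z p.1 p.2)) :
    Measurable (fun x => ∫ s, Z s x ∂μ) :=
  (hZ.stronglyMeasurable.integral_prod_left).measurable

theorem bdd_mean {S : Type*} [MeasurableSpace S]
    (μ : Measure S) [IsProbabilityMeasure μ] (Z : S → ℝ) (M : ℝ) (hM : ∀ s, |Z s| ≤ M) :
    |∫ s, Z s ∂μ| ≤ M := by
  have := norm_integral_le_of_norm_le_const (μ := μ) (f := Z) (Eventually.of_forall hM)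
  simpa using this

/-- affine phase of a sample `(ξ, s)` -/
def ph {d : ℕ} (ω : (Fin d → ℝ) × ℝ) (x : Fin d → ℝ) : ℝ := ∑ i, ω.1 i * x i - ω.2

theorem weak_tri {d : ℕ} (ω : (Fin d → ℝ) × ℝ) (j : Fin d) (φ : (Fin d → ℝ) → ℝ)
    (hφ : ContDiff ℝ (⊤ : ℕ∞) φ) (hs : HasCompactSupport φ) :
    ∫ x, tri (ph ω x) * fderiv ℝ φ x (Pi.single j 1) =
      - ∫ x, (ω.1 j * deriv tri (ph ω x)) * φ x := by
  have hlin : ∃ K, LipschitzWith K (ph ω) := by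
    refine ⟨∑ i, ‖ω.1 i‖₊, LipschitzWith.of_dist_le_mul fun x y => ?_⟩
    simp only [ph, Real.dist_eq, sub_sub_sub_cancel_right]
    rw [← Finset.sum_sub_distrib]
    refine (Finset.abs_sum_le_sum_abs _ _).trans ?_
    push_cast
    rw [Finset.sum_mul]
    refine Finset.sum_le_sum fun i _ => ?_
    rw [← mul_sub, abs_mul]
    exact mul_le_mul_of_nonneg_left (dist_le_pi_dist x y i) (abs_nonneg _)
  obtain ⟨K, hK⟩ := hlin
  have h1 : LipschitzWith (2 * K) (fun x => tri (ph ω x)) := tri_lip.comp hK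
  obtain ⟨D, hD⟩ := (hφ.of_le (by exact_mod_cast le_top : (1 : WithTop ℕ∞) ≤ _)).lipschitzWith_of_hasCompactSupport hs (by simp)
  have key := h1.integral_lineDeriv_mul_eq (μ := volume) hD hs (Pi.single j 1)
  have e1 : ∀ x, lineDeriv ℝ (fun x => tri (ph ω x)) x (Pi.single j 1) = ω.1 j * deriv tri (ph ω x) := by
    intro x
    unfold lineDeriv
    have : ∀ t : ℝ, ph ω (x + t • Pi.single j 1) = ph ω x + ω.1 j * t := by
      intro t
      simp [ph, mul_add, Finset.sum_add_distrib, Pi.single_apply]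
      ring
    simp_rw [this]
    have := deriv_comp_mul_left (ω.1 j) (fun t => tri (ph ω x + t)) 0
    rw [this, deriv_comp_const_add]
    simp
  have e2 : ∀ x, lineDeriv ℝ φ x (-Pi.single j 1) = - fderiv ℝ φ x (Pi.single j 1) := by
    intro x
    rw [(hφ.differentiable (by simp)).differentiableAt.lineDeriv_eq_fderiv]; simp
  simp_rw [e1, e2] at key
  rw [key, ← integral_neg]
  congr 1; ext x; ring

/-- sampling coefficient -/
def coef {d : ℕ} (G : (Fin d → ℝ) → ℂ) (B : ℝ) (ω : (Fin d → ℝ) × ℝ) : ℝ :=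
  -(π ^ 2 / 2) * (B / (1 + l1 ω.1)) * Real.cos (2 * π * ω.2 + (G ω.1).arg)

/-- the random functions: value (`none`) and partial derivatives (`some j`) -/
def Zf {d : ℕ} (G : (Fin d → ℝ) → ℂ) (B : ℝ) (i : Option (Fin d)) (ω : (Fin d → ℝ) × ℝ)
    (x : Fin d → ℝ) : ℝ :=
  i.elim (coef G B ω * tri (ph ω x)) (fun j => coef G B ω * (ω.1 j * deriv tri (ph ω x)))

theorem l1_cont {d : ℕ} : Continuous (l1 : (Fin d → ℝ) → ℝ) := by unfold l1; fun_prop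

theorem Zf_meas {d : ℕ} (G : (Fin d → ℝ) → ℂ) (hG : Continuous G) (B : ℝ) (i : Option (Fin d)) :
    Measurable (fun p : ((Fin d → ℝ) × ℝ) × (Fin d → ℝ) => Zf G B i p.1 p.2) := by
  have hp : Measurable (fun p : ((Fin d → ℝ) × ℝ) × (Fin d → ℝ) => ph p.1 p.2) := by
    unfold ph; apply Continuous.measurable; fun_prop
  have hc : Measurable (coef G B) := by
    unfold coef
    have := (l1_cont (d := d)).measurable
    have := hG.measurable
    have := Complex.measurable_arg
    fun_prop
  have ht := tri_cont.measurable
  have hd := measurable_deriv tri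
  cases i with
  | none => simp only [Zf, Option.elim]; fun_prop
  | some j => simp only [Zf, Option.elim]; fun_prop

theorem coef_bound {d : ℕ} (G : (Fin d → ℝ) → ℂ) (B : ℝ) (hB : 0 < B) (ω : (Fin d → ℝ) × ℝ) :
    |coef G B ω| ≤ π ^ 2 / 2 * (B / (1 + l1 ω.1)) := by
  have := l1_nonneg ω.1
  unfold coef
  rw [abs_mul, abs_mul, abs_neg, abs_of_nonneg (by positivity : 0 ≤ π ^ 2 / 2),
    abs_of_nonneg (by positivity : 0 ≤ B / (1 + l1 ω.1))]
  exact mul_le_of_le_one_right (by positivity) (Real.abs_cos_le_one _)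

theorem deriv_tri_bound (t : ℝ) : |deriv tri t| ≤ 2 := by
  simpa using norm_deriv_le_of_lipschitz (x₀ := t) tri_lip

theorem Zf_sq {d : ℕ} (G : (Fin d → ℝ) → ℂ) (B : ℝ) (hB : 0 < B) (ω : (Fin d → ℝ) × ℝ)
    (x : Fin d → ℝ) : ∑ i, Zf G B i ω x ^ 2 ≤ (π ^ 2 * B) ^ 2 := by
  have hl := l1_nonneg ω.1
  have hc : coef G B ω ^ 2 ≤ (π ^ 2 / 2 * (B / (1 + l1 ω.1))) ^ 2 :=
    sq_le_sq.2 ((coef_bound G B hB ω).trans (le_abs_self _))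
  have ht : tri (ph ω x) ^ 2 ≤ 1 := by
    have := tri_nonneg (ph ω x); have := tri_le_one (ph ω x); nlinarith
  have hd : deriv tri (ph ω x) ^ 2 ≤ 4 := by
    have := sq_le_sq.2 ((deriv_tri_bound (ph ω x)).trans (le_abs_self _)); linarith
  have h2 : ∑ j, ω.1 j ^ 2 ≤ l1 ω.1 ^ 2 := by
    have := Finset.sum_sq_le_sq_sum_of_nonneg (s := Finset.univ) (f := fun j => |ω.1 j|) (fun j _ => abs_nonneg _)
    simpa [l1] using this
  rw [Fintype.sum_option]
  simp only [Zf, Option.elim, mul_pow]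
  have : ∑ j, coef G B ω ^ 2 * (ω.1 j ^ 2 * deriv tri (ph ω x) ^ 2) = 
      coef G B ω ^ 2 * ((∑ j, ω.1 j ^ 2) * deriv tri (ph ω x) ^ 2) := by
    rw [Finset.sum_mul, Finset.mul_sum]
  rw [this, ← mul_add]
  have h3 : tri (ph ω x) ^ 2 + (∑ j, ω.1 j ^ 2) * deriv tri (ph ω x) ^ 2 ≤ 4 * (1 + l1 ω.1) ^ 2 := by
    have := mul_le_mul h2 hd (sq_nonneg _) (sq_nonneg _)
    nlinarith
  refine (mul_le_mul hc h3 (add_nonneg (sq_nonneg _) (mul_nonneg (Finset.sum_nonneg fun _ _ => sq_nonneg _) (sq_nonneg _))) (sq_nonneg _)).trans_eq ?_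
  field_simp
  norm_num

theorem Zf_bound {d : ℕ} (G : (Fin d → ℝ) → ℂ) (B : ℝ) (hB : 0 < B) (i : Option (Fin d)) (ω : (Fin d → ℝ) × ℝ)
    (x : Fin d → ℝ) : |Zf G B i ω x| ≤ π ^ 2 * B := by
  apply abs_le_of_sq_le_sq _ (by positivity)
  refine le_trans ?_ (Zf_sq G B hB ω x)
  exact Finset.single_le_sum (f := fun i => Zf G B i ω x ^ 2) (fun _ _ => sq_nonneg _) (Finset.mem_univ i)

/-- frequency sampling measure -/
def mu1 {d : ℕ} (G : (Fin d → ℝ) → ℂ) : Measure (Fin d → ℝ) :=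
  volume.withDensity (fun ξ => ENNReal.ofReal ((1 + l1 ξ) * ‖G ξ‖ / B1 G))

/-- sampling measure -/
def mu {d : ℕ} (G : (Fin d → ℝ) → ℂ) : Measure ((Fin d → ℝ) × ℝ) :=
  (mu1 G).prod (volume.restrict (Set.Ioc 0 1))

theorem mu1_int {d : ℕ} (G : (Fin d → ℝ) → ℂ) (hG : Continuous G) (hB : 0 < B1 G)
    (h : (Fin d → ℝ) → ℝ) :
    ∫ ξ, h ξ ∂(mu1 G) = ∫ ξ, ((1 + l1 ξ) * ‖G ξ‖ / B1 G) * h ξ := by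
  unfold mu1
  have := (l1_cont (d := d))
  rw [integral_withDensity_eq_integral_toReal_smul (by fun_prop) (by simp)]
  congr 1; ext ξ
  have := l1_nonneg ξ
  rw [ENNReal.toReal_ofReal (by positivity)]; rfl

theorem mu1_prob {d : ℕ} (G : (Fin d → ℝ) → ℂ) (hB : 0 < B1 G) :
    IsProbabilityMeasure (mu1 G) := by
  constructor
  unfold mu1
  have hi : Integrable (fun ξ => (1 + l1 ξ) * ‖G ξ‖) := by
    by_contra h
    unfold B1 at hB
    rw [integral_undef h] at hB
    exact lt_irrefl _ hB
  rw [withDensity_apply _ MeasurableSet.univ, Measure.restrict_univ,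
    ← ofReal_integral_eq_lintegral_ofReal (hi.div_const _)]
  · rw [integral_div]
    change ENNReal.ofReal (B1 G / B1 G) = 1
    rw [div_self hB.ne']; simp
  · filter_upwards with ξ
    have := l1_nonneg ξ
    simp only [Pi.zero_apply]; positivity

theorem mu_prob {d : ℕ} (G : (Fin d → ℝ) → ℂ) (hB : 0 < B1 G) :
    IsProbabilityMeasure (mu G) := by
  have := mu1_prob G hB
  have : IsProbabilityMeasure (volume.restrict (Set.Ioc (0:ℝ) 1)) := ⟨by simp⟩
  unfold mu; infer_instance

theorem mu_cost {d : ℕ} (G : (Fin d → ℝ) → ℂ) (hG : Continuous G) (hB : 0 < B1 G)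
    (hlog : Integrable (fun ξ => (1 + l1 ξ) * Real.logb 2 (2 + l1 ξ) * ‖G ξ‖)) :
    Integrable (fun ω : (Fin d → ℝ) × ℝ => Real.logb 2 (2 + l1 ω.1)) (mu G) ∧
    ∫ ω : (Fin d → ℝ) × ℝ, Real.logb 2 (2 + l1 ω.1) ∂(mu G) = B1log G / B1 G := by
  have := mu1_prob G hB
  have : IsProbabilityMeasure (volume.restrict (Set.Ioc (0:ℝ) 1)) := ⟨by simp⟩
  have hl1 := (l1_cont (d := d))
  have hi : Integrable (fun ξ => Real.logb 2 (2 + l1 ξ)) (mu1 G) := by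
    unfold mu1
    rw [integrable_withDensity_iff_integrable_smul' (by fun_prop) (by simp)]
    refine (hlog.div_const (B1 G)).congr ?_
    filter_upwards with ξ
    have := l1_nonneg ξ
    rw [ENNReal.toReal_ofReal (by positivity), smul_eq_mul]; ring
  have hi2 : Integrable (fun ω : (Fin d → ℝ) × ℝ => Real.logb 2 (2 + l1 ω.1)) (mu G) := by
    unfold mu
    exact hi.comp_fst _
  refine ⟨hi2, ?_⟩
  unfold mu at hi2 ⊢
  rw [integral_prod _ hi2]
  simp only [integral_const, probReal_univ, one_smul]
  rw [mu1_int G hG hB, B1log, ← integral_div]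
  congr 1; ext ξ; ring

theorem mu_mean {d : ℕ} (G : (Fin d → ℝ) → ℂ) (hG : Continuous G) (hB : 0 < B1 G) (x : Fin d → ℝ) :
    ∫ ω, Zf G (B1 G) none ω x ∂(mu G) = 
      ∫ ξ, ‖G ξ‖ * Real.cos (2 * π * (∑ i, ξ i * x i) + (G ξ).arg) := by
  have := mu1_prob G hB
  have : IsProbabilityMeasure (volume.restrict (Set.Ioc (0:ℝ) 1)) := ⟨by simp⟩
  have := mu_prob G hB
  have hm : Measurable (fun ω => Zf G (B1 G) none ω x) :=
    meas_sec1 _ (Zf_meas G hG (B1 G) none) x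
  have hi : Integrable (fun ω => Zf G (B1 G) none ω x) (mu G) :=
    Integrable.of_bound hm.aestronglyMeasurable (π ^ 2 * B1 G)
      (Eventually.of_forall fun ω => Zf_bound G (B1 G) hB none ω x)
  unfold mu at hi ⊢
  rw [integral_prod _ hi, mu1_int G hG hB]
  congr 1; ext ξ
  have e : ∀ s, Zf G (B1 G) none (ξ, s) x = (-(π ^ 2 / 2) * (B1 G / (1 + l1 ξ))) *
      (Real.cos (2 * π * s + (G ξ).arg) * tri (∑ i, ξ i * x i - s)) := by
    intro s; simp only [Zf, Option.elim, coef, ph]; ring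
  simp_rw [e]
  rw [integral_const_mul, tri_cos_int]
  have := l1_nonneg ξ
  have := hB.ne'
  have := Real.pi_ne_zero
  have : 1 + l1 ξ ≠ 0 := by positivity
  field_simp

theorem mean_weak {d : ℕ} (G : (Fin d → ℝ) → ℂ) (hG : Continuous G) (hB : 0 < B1 G) (j : Fin d)
    (φ : (Fin d → ℝ) → ℝ) (hφ : ContDiff ℝ (⊤ : ℕ∞) φ) (hs : HasCompactSupport φ) :
    ∫ x, (∫ ω, Zf G (B1 G) none ω x ∂(mu G)) * fderiv ℝ φ x (Pi.single j 1) =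
      - ∫ x, (∫ ω, Zf G (B1 G) (some j) ω x ∂(mu G)) * φ x := by
  have := mu_prob G hB
  have gen : ∀ (i : Option (Fin d)) (ψ : (Fin d → ℝ) → ℝ), Integrable ψ →
      ∫ x, (∫ ω, Zf G (B1 G) i ω x ∂(mu G)) * ψ x = ∫ ω, (∫ x, Zf G (B1 G) i ω x * ψ x) ∂(mu G) := by
    intro i ψ hψ
    rw [integral_integral_swap]
    · simp_rw [integral_mul_const]
    · have h1 : Integrable (fun p : ((Fin d → ℝ) × ℝ) × (Fin d → ℝ) => ψ p.2) ((mu G).prod volume) :=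
        hψ.comp_snd _
      exact h1.bdd_mul (c := π ^ 2 * B1 G) (Zf_meas G hG _ i).aestronglyMeasurable
        (Eventually.of_forall fun p => Zf_bound G _ hB i p.1 p.2)
  have hc1 : Continuous φ := hφ.continuous
  have hc2 : Continuous (fun x => fderiv ℝ φ x (Pi.single j 1)) :=
    (hφ.continuous_fderiv (by simp)).clm_apply continuous_const
  have hs2 : HasCompactSupport (fun x => fderiv ℝ φ x (Pi.single j 1)) :=
    (hs.fderiv ℝ).comp_left (g := fun L : (Fin d → ℝ) →L[ℝ] ℝ => L (Pi.single j 1)) (by simp)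
  rw [gen none _ (hc2.integrable_of_hasCompactSupport hs2),
    gen (some j) _ (hc1.integrable_of_hasCompactSupport hs), ← integral_neg]
  congr 1; ext ω
  have := weak_tri ω j φ hφ hs
  simp only [Zf, Option.elim, mul_assoc (coef G (B1 G) ω)]
  rw [integral_const_mul, integral_const_mul, this]
  ring

/-- the error functions -/
def Er {d : ℕ} (G : (Fin d → ℝ) → ℂ) (m : ℕ) (ω : ℕ → (Fin d → ℝ) × ℝ) (i : Option (Fin d))
    (x : Fin d → ℝ) : ℝ :=
  (∫ t, Zf G (B1 G) i t x ∂(mu G)) - ∑ k ∈ Finset.range m, (1 / (m : ℝ)) * Zf G (B1 G) i (ω k) x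

theorem Er_meas {d : ℕ} (G : (Fin d → ℝ) → ℂ) (hG : Continuous G) (hB : 0 < B1 G) (m : ℕ)
    (ω : ℕ → (Fin d → ℝ) × ℝ) (i : Option (Fin d)) : Measurable (Er G m ω i) := by
  have := mu_prob G hB
  unfold Er
  refine Measurable.sub (meas_mean (mu G) _ (Zf_meas G hG (B1 G) i)) ?_
  refine Finset.measurable_fun_sum _ fun k _ => ?_
  exact (meas_sec2 _ (Zf_meas G hG (B1 G) i) (ω k)).const_mul _

theorem Er_bdd {d : ℕ} (G : (Fin d → ℝ) → ℂ) (hB : 0 < B1 G) (m : ℕ)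
    (ω : ℕ → (Fin d → ℝ) × ℝ) (i : Option (Fin d)) : ∃ M, ∀ x, |Er G m ω i x| ≤ M := by
  have := mu_prob G hB
  refine ⟨π ^ 2 * B1 G + ∑ k ∈ Finset.range m, (1 / (m : ℝ)) * (π ^ 2 * B1 G), fun x => ?_⟩
  unfold Er
  refine (abs_sub _ _).trans (add_le_add ?_ ?_)
  · exact bdd_mean (mu G) _ _ fun s => Zf_bound G (B1 G) hB i s x
  · refine (Finset.abs_sum_le_sum_abs _ _).trans (Finset.sum_le_sum fun k _ => ?_)
    rw [abs_mul, abs_of_nonneg (by positivity : 0 ≤ 1 / (m : ℝ))]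
    exact mul_le_mul_of_nonneg_left (Zf_bound G (B1 G) hB i (ω k) x) (by positivity)

theorem Er_weak {d : ℕ} (G : (Fin d → ℝ) → ℂ) (hG : Continuous G) (hB : 0 < B1 G) (m : ℕ)
    (ω : ℕ → (Fin d → ℝ) × ℝ) (j : Fin d)
    (φ : (Fin d → ℝ) → ℝ) (hφ : ContDiff ℝ (⊤ : ℕ∞) φ) (hs : HasCompactSupport φ) :
    ∫ x, Er G m ω none x * fderiv ℝ φ x (Pi.single j 1) = - ∫ x, Er G m ω (some j) x * φ x := by
  have := mu_prob G hB
  have gen : ∀ (i : Option (Fin d)) (ψ : (Fin d → ℝ) → ℝ), Integrable ψ →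
      ∫ x, Er G m ω i x * ψ x = (∫ x, (∫ t, Zf G (B1 G) i t x ∂(mu G)) * ψ x) -
        ∑ k ∈ Finset.range m, (1 / (m : ℝ)) * ∫ x, Zf G (B1 G) i (ω k) x * ψ x := by
    intro i ψ hψ
    have i1 : Integrable (fun x => (∫ t, Zf G (B1 G) i t x ∂(mu G)) * ψ x) :=
      hψ.bdd_mul (c := π ^ 2 * B1 G)
        (meas_mean (mu G) _ (Zf_meas G hG (B1 G) i)).aestronglyMeasurable
        (Eventually.of_forall fun x => bdd_mean (mu G) _ _ fun s => Zf_bound G (B1 G) hB i s x)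
    have i2 : ∀ k, Integrable (fun x => Zf G (B1 G) i (ω k) x * ψ x) := fun k =>
      hψ.bdd_mul (c := π ^ 2 * B1 G)
        (meas_sec2 _ (Zf_meas G hG (B1 G) i) (ω k)).aestronglyMeasurable
        (Eventually.of_forall fun x => Zf_bound G (B1 G) hB i (ω k) x)
    have e : ∀ x, Er G m ω i x * ψ x = (∫ t, Zf G (B1 G) i t x ∂(mu G)) * ψ x -
        ∑ k ∈ Finset.range m, (1 / (m : ℝ)) * (Zf G (B1 G) i (ω k) x * ψ x) := by
      intro x
      unfold Er
      rw [sub_mul, Finset.sum_mul]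
      simp only [mul_assoc]
    simp_rw [e]
    rw [integral_sub i1 (integrable_finsetSum _ fun k _ => (i2 k).const_mul _),
      integral_finsetSum _ fun k _ => (i2 k).const_mul _]
    simp_rw [integral_const_mul]
  have hc1 : Continuous φ := hφ.continuous
  have hc2 : Continuous (fun x => fderiv ℝ φ x (Pi.single j 1)) :=
    (hφ.continuous_fderiv (by simp)).clm_apply continuous_const
  have hs2 : HasCompactSupport (fun x => fderiv ℝ φ x (Pi.single j 1)) :=
    (hs.fderiv ℝ).comp_left (g := fun L : (Fin d → ℝ) →L[ℝ] ℝ => L (Pi.single j 1)) (by simp)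
  rw [gen none _ (hc2.integrable_of_hasCompactSupport hs2),
    gen (some j) _ (hc1.integrable_of_hasCompactSupport hs), mean_weak G hG hB j φ hφ hs, neg_sub',
    sub_right_inj, ← Finset.sum_neg_distrib]
  refine Finset.sum_congr rfl fun k _ => ?_
  have := weak_tri (ω k) j φ hφ hs
  simp only [Zf, Option.elim, mul_assoc (coef G (B1 G) (ω k))]
  rw [integral_const_mul, integral_const_mul, this]
  ring

theorem Er_hasWeak {d : ℕ} (G : (Fin d → ℝ) → ℂ) (hG : Continuous G) (hB : 0 < B1 G) (m : ℕ)
    (ω : ℕ → (Fin d → ℝ) × ℝ) (j : Fin d) (Ω : Set (Fin d → ℝ))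
    (u : (Fin d → ℝ) → ℝ) (hu : ∀ᵐ x ∂(volume.restrict Ω), u x = Er G m ω none x) :
    HasWeakPartial Ω u j (Er G m ω (some j)) := by
  intro φ hφ hs hsub
  have hz : ∀ x, x ∉ Ω → φ x = 0 := fun x hx =>
    image_eq_zero_of_notMem_tsupport fun h => hx (interior_subset (hsub h))
  have hz2 : ∀ x, x ∉ Ω → fderiv ℝ φ x (Pi.single j 1) = 0 := fun x hx => by
    have : x ∉ tsupport (fderiv ℝ φ) := fun h =>
      hx (interior_subset (hsub (tsupport_fderiv_subset ℝ h)))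
    rw [image_eq_zero_of_notMem_tsupport this]; simp
  have h1 : ∫ x in Ω, u x * fderiv ℝ φ x (Pi.single j 1) =
      ∫ x in Ω, Er G m ω none x * fderiv ℝ φ x (Pi.single j 1) := by
    apply integral_congr_ae
    filter_upwards [hu] with x hx
    rw [hx]
  rw [h1, setIntegral_eq_integral_of_forall_compl_eq_zero (fun x hx => by rw [hz2 x hx, mul_zero]),
    setIntegral_eq_integral_of_forall_compl_eq_zero (fun x hx => by rw [hz x hx, mul_zero])]
  exact Er_weak G hG hB m ω j φ hφ hs

theorem depth_arith (m C cb S L : ℝ) (hm : 1 ≤ m) (hC : 1 ≤ C) (hcb : 1 ≤ cb)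
    (hS : 15 * S ≤ 16 * m * cb) (hL : L ≤ 2 + (S + m * (4 + Real.logb 2 C))) :
    L ≤ 6 * m * C * Real.logb 2 (2 + C) * cb := by
  set l := Real.logb 2 (2 + C)
  have h1 : Real.logb 2 C ≤ l := Real.logb_le_logb_of_le (by norm_num) (by linarith) (by linarith)
  have h2 : 3 / 2 ≤ l := by
    have : Real.logb 2 3 ≤ l := Real.logb_le_logb_of_le (by norm_num) (by linarith) (by linarith)
    refine le_trans ?_ this
    have h9 : Real.logb 2 8 ≤ Real.logb 2 (3 ^ 2) :=
      Real.logb_le_logb_of_le (by norm_num) (by norm_num) (by norm_num)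
    rw [show (8 : ℝ) = 2 ^ 3 by norm_num, Real.logb_pow, Real.logb_pow,
      Real.logb_self_eq_one (by norm_num)] at h9
    push_cast at h9
    linarith
  have h3 : 16 / 15 * cb + 6 + l ≤ 6 * l * cb := by nlinarith
  have h4 : L ≤ m * (16 / 15 * cb + 6 + l) := by nlinarith
  have h5 : m * (16 / 15 * cb + 6 + l) ≤ m * (6 * l * cb) := by gcongr
  have h6 : 0 ≤ m * (6 * l * cb) := by positivity
  nlinarith

theorem coord_le {d : ℕ} (Ω : Set (Fin d → ℝ)) (hΩc : IsCompact Ω) (x : Fin d → ℝ) (hx : x ∈ Ω)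
    (y : Fin d → ℝ) (hy : y ∈ Ω) (i : Fin d) : |x i - y i| ≤ eucDiam Ω := by
  have hb : BddAbove {r : ℝ | ∃ x ∈ Ω, ∃ y ∈ Ω, r = Real.sqrt (∑ i, (x i - y i) ^ 2)} := by
    have hc : Continuous (fun p : (Fin d → ℝ) × (Fin d → ℝ) =>
        Real.sqrt (∑ i, (p.1 i - p.2 i) ^ 2)) := by fun_prop
    refine ((hΩc.prod hΩc).bddAbove_image hc.continuousOn).mono ?_
    rintro r ⟨x, hx, y, hy, rfl⟩
    exact ⟨(x, y), ⟨hx, hy⟩, rfl⟩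
  refine le_trans ?_ (le_csSup hb ⟨x, hx, y, hy, rfl⟩)
  rw [← Real.sqrt_sq_eq_abs]
  apply Real.sqrt_le_sqrt
  exact Finset.single_le_sum (f := fun i => (x i - y i) ^ 2) (fun _ _ => sq_nonneg _)
    (Finset.mem_univ i)

theorem cbar_ge {d : ℕ} (G : (Fin d → ℝ) → ℂ) (hG : Continuous G) (hB : 0 < B1 G)
    (hlog : Integrable (fun ξ => (1 + l1 ξ) * Real.logb 2 (2 + l1 ξ) * ‖G ξ‖)) :
    1 ≤ B1log G / B1 G := by
  have := mu_prob G hB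
  obtain ⟨h1, h2⟩ := mu_cost G hG hB hlog
  rw [← h2]
  have h3 : ∫ ω, (1 : ℝ) ∂(mu G) ≤ _ := integral_mono (integrable_const _) h1 (fun ω => by
    have := l1_nonneg ω.1
    change 1 ≤ Real.logb 2 (2 + l1 ω.1)
    rw [Real.le_logb_iff_rpow_le (by norm_num) (by positivity)]
    simpa using this)
  simpa using h3

theorem main_sample {d : ℕ} (G : (Fin d → ℝ) → ℂ) (hG : Continuous G) (hB : 0 < B1 G)
    (hlog : Integrable (fun ξ => (1 + l1 ξ) * Real.logb 2 (2 + l1 ξ) * ‖G ξ‖))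
    (m : ℕ) (hm : 0 < m) (Ω : Set (Fin d → ℝ)) (hfin : volume Ω ≠ ⊤) (hpos : volume Ω ≠ 0) :
    ∃ ω : ℕ → (Fin d → ℝ) × ℝ,
      15 * ∑ k ∈ Finset.range m, Real.logb 2 (2 + l1 (ω k).1) ≤ 16 * m * (B1log G / B1 G) ∧
      ∑ i, ∫ x in Ω, Er G m ω i x ^ 2 ≤ 16 * ((π ^ 2 * B1 G) ^ 2 * (volume Ω).toReal) / m := by
  have := mu_prob G hB
  obtain ⟨c1, c2⟩ := mu_cost G hG hB hlog
  have hcb := cbar_ge G hG hB hlog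
  set cb := B1log G / B1 G
  have hv : 0 < (volume Ω).toReal := ENNReal.toReal_pos hpos hfin
  set V := (π ^ 2 * B1 G) ^ 2 * (volume Ω).toReal with hVdef
  have hVpos : 0 < V := by positivity
  have : Fact (volume Ω < ⊤) := ⟨hfin.lt_top⟩
  have hV : ∀ s, ∑ i, ∫ x, Zf G (B1 G) i s x ^ 2 ∂(volume.restrict Ω) ≤ V := by
    intro s
    have ii : ∀ i, Integrable (fun x => Zf G (B1 G) i s x ^ 2) (volume.restrict Ω) := by
      intro i
      refine int_of_bdd ((meas_sec2 _ (Zf_meas G hG (B1 G) i) s).pow_const 2) ((π ^ 2 * B1 G) ^ 2) ?_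
      intro x
      rw [abs_of_nonneg (sq_nonneg _), sq_le_sq]
      exact (Zf_bound G (B1 G) hB i s x).trans (le_abs_self _)
    rw [← integral_finsetSum _ fun i _ => ii i]
    refine (integral_mono (integrable_finsetSum _ fun i _ => ii i)
      (integrable_const ((π ^ 2 * B1 G) ^ 2)) (fun x => Zf_sq G (B1 G) hB s x)).trans_eq ?_
    simp [hVdef, Measure.real, mul_comm]
  obtain ⟨ω, hω⟩ := maurey (mu G) (volume.restrict Ω) (fun i s x => Zf G (B1 G) i s x)
    (fun i => Zf_meas G hG (B1 G) i) (π ^ 2 * B1 G) (fun i s x => Zf_bound G (B1 G) hB i s x) V hV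
    (fun ω => Real.logb 2 (2 + l1 ω.1)) c1 cb (15 * V) (by linarith) m
  rw [c2] at hω
  have hm' : (0 : ℝ) < m := by exact_mod_cast hm
  have hcost : 0 ≤ ∑ j ∈ Finset.range m, Real.logb 2 (2 + l1 (ω j).1) :=
    Finset.sum_nonneg fun j _ => Real.logb_nonneg (by norm_num) (by
      have := l1_nonneg (ω j).1; linarith)
  set A := ∑ i, ∫ x in Ω, (∑ j ∈ Finset.range m, Zf G (B1 G) i (ω j) x -
    m * ∫ t, Zf G (B1 G) i t x ∂(mu G)) ^ 2 with hA
  have hApos : 0 ≤ A := Finset.sum_nonneg fun i _ => integral_nonneg fun x => sq_nonneg _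
  set S := ∑ j ∈ Finset.range m, Real.logb 2 (2 + l1 (ω j).1)
  have hω' : cb * A + 15 * V * S ≤ m * (cb * V + 15 * V * cb) := hω
  refine ⟨ω, ?_, ?_⟩
  · have h1 : V * (15 * S) ≤ V * (16 * m * cb) := by
      have : 0 ≤ cb * A := by positivity
      linarith
    exact le_of_mul_le_mul_left h1 hVpos
  · have h1 : cb * A ≤ cb * (16 * m * V) := by
      have : 0 ≤ V * S := by positivity
      linarith
    have h2 := le_of_mul_le_mul_left h1 (by linarith : 0 < cb)
    have e : ∑ i, ∫ x in Ω, Er G m ω i x ^ 2 = (1 / (m : ℝ)) ^ 2 * A := by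
      rw [hA, Finset.mul_sum]
      refine Finset.sum_congr rfl fun i _ => ?_
      rw [← integral_const_mul]
      congr 1; ext x
      unfold Er
      rw [← Finset.mul_sum]
      field_simp
      ring
    rw [e]
    calc (1 / (m : ℝ)) ^ 2 * A ≤ (1 / (m : ℝ)) ^ 2 * (16 * m * V) := by gcongr
      _ = 16 * V / m := by field_simp
/-- If `f : ℝ^d → ℝ` has `f̂ ∈ L¹`, `‖f‖_{B^{1,log}} < ∞` and
`‖f‖_{B¹} > 0`, then for every `m ≥ 1` and compact `Ω ⊂ ℝ^d`, with
`C₂ = max{1, diam Ω}`, there is a ReLU network `F` of width `d+4` and depth at most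
`6m C₂ log₂(2+C₂) ‖f‖_{B^{1,log}}/‖f‖_{B¹}` such that `f - F` has weak partials `v_j` on
`Ω` and `‖f - F‖_{H¹(Ω)} ≤ (4π²/√m) C₂ |Ω|^{1/2} ‖f‖_{B¹}`
(stated as the equivalent squared bound). -/
theorem H1_approx_general (d : ℕ) (f : (Fin d → ℝ) → ℝ)
    (hf1 : Integrable (fhatR f))
    (hf1log : Integrable (fun ξ => (1 + l1 ξ) * Real.logb 2 (2 + l1 ξ) * ‖fhatR f ξ‖))
    (hB1 : 0 < B1 (fhatR f))
    (m : ℕ) (hm : 0 < m)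
    (Ω : Set (Fin d → ℝ)) (hΩc : IsCompact Ω) :
    ∃ (L : ℕ) (F : (Fin d → ℝ) → ℝ) (v : Fin d → (Fin d → ℝ) → ℝ),
      IsReLUNet d (d + 4) L F ∧
      (L : ℝ) ≤ 6 * m * max 1 (eucDiam Ω) * Real.logb 2 (2 + max 1 (eucDiam Ω)) *
        B1log (fhatR f) / B1 (fhatR f) ∧
      (∀ j, HasWeakPartial Ω (fun x => f x - F x) j (v j)) ∧
      ((∫⁻ x in Ω, ENNReal.ofReal ((f x - F x) ^ 2)) +
        ∑ j : Fin d, ∫⁻ x in Ω, ENNReal.ofReal (v j x ^ 2)) ≤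
        ENNReal.ofReal ((4 * Real.pi ^ 2 / Real.sqrt m * max 1 (eucDiam Ω) *
          Real.sqrt ((volume Ω).toReal) * B1 (fhatR f)) ^ 2) := by
  obtain ⟨hG, hfm, hinv⟩ := fhatR_facts f hf1 hB1
  have hcb := cbar_ge (fhatR f) hG hB1 hf1log
  have hC : 1 ≤ max 1 (eucDiam Ω) := le_max_left _ _
  have hm1 : (1 : ℝ) ≤ m := by exact_mod_cast hm
  have hfin : volume Ω ≠ ⊤ := hΩc.measure_lt_top.ne
  by_cases hpos : volume Ω = 0
  · have hr : volume.restrict Ω = 0 := Measure.restrict_eq_zero.2 hpos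
    refine ⟨0, fun _ => 0, fun _ _ => 0, ⟨0, 0, fun _ => 0, fun _ => 0, 0, by simp⟩, ?_, ?_, ?_⟩
    · have hl : 0 ≤ Real.logb 2 (2 + max 1 (eucDiam Ω)) :=
        Real.logb_nonneg (by norm_num) (by linarith)
      rw [mul_div_assoc]
      push_cast
      positivity
    · intro j φ _ _ _
      simp [hr]
    · simp [hr]
  obtain ⟨x0, hx0⟩ : Ω.Nonempty := by
    rw [Set.nonempty_iff_ne_empty]
    rintro rfl
    simp at hpos
  obtain ⟨ω, hω1, hω2⟩ := main_sample (fhatR f) hG hB1 hf1log m hm Ω hfin hpos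
  obtain ⟨L, F, hF, hL, hFx⟩ := net_build Ω x0 (max 1 (eucDiam Ω)) hC
    (fun x hx i => (coord_le Ω hΩc x hx x0 hx0 i).trans (le_max_right _ _))
    (fun k => 1 / (m : ℝ) * coef (fhatR f) (B1 (fhatR f)) (ω k)) (fun k => (ω k).1)
    (fun k => (ω k).2) m
  have hu : ∀ᵐ x ∂(volume.restrict Ω), f x - F x = Er (fhatR f) m ω none x := by
    filter_upwards [ae_restrict_of_ae hinv, ae_restrict_mem hΩc.measurableSet] with x hx hxΩ
    rw [hFx x hxΩ, hx, ← mu_mean (fhatR f) hG hB1 x]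
    unfold Er
    congr 1
    refine Finset.sum_congr rfl fun k _ => ?_
    simp only [Zf, Option.elim, ph, mul_assoc]
  refine ⟨L, F, fun j => Er (fhatR f) m ω (some j), hF, ?_, ?_, ?_⟩
  · rw [mul_div_assoc]
    refine depth_arith m _ _ _ L hm1 hC hcb hω1 (hL.trans_eq ?_)
    simp only [add_assoc]
    rw [Finset.sum_add_distrib, Finset.sum_const]
    simp [mul_add]
  · intro j
    exact Er_hasWeak (fhatR f) hG hB1 m ω j Ω _ hu
  · have : Fact (volume Ω < ⊤) := ⟨hfin.lt_top⟩
    have e1 : ∀ i, ∫⁻ x in Ω, ENNReal.ofReal (Er (fhatR f) m ω i x ^ 2) =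
        ENNReal.ofReal (∫ x in Ω, Er (fhatR f) m ω i x ^ 2) := by
      intro i
      obtain ⟨M, hM⟩ := Er_bdd (fhatR f) hB1 m ω i
      refine (ofReal_integral_eq_lintegral_ofReal ?_ (Eventually.of_forall fun x => sq_nonneg _)).symm
      refine int_of_bdd ((Er_meas (fhatR f) hG hB1 m ω i).pow_const 2) (M ^ 2) ?_
      intro x
      rw [abs_of_nonneg (sq_nonneg _), sq_le_sq]
      exact (hM x).trans (le_abs_self _)
    have e0 : ∫⁻ x in Ω, ENNReal.ofReal ((f x - F x) ^ 2) =
        ∫⁻ x in Ω, ENNReal.ofReal (Er (fhatR f) m ω none x ^ 2) := by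
      apply lintegral_congr_ae
      filter_upwards [hu] with x hx
      rw [hx]
    rw [e0, ← Fintype.sum_option
      (fun i => ∫⁻ x in Ω, ENNReal.ofReal (Er (fhatR f) m ω i x ^ 2))]
    simp_rw [e1]
    rw [← ENNReal.ofReal_sum_of_nonneg fun i _ => integral_nonneg fun x => sq_nonneg _]
    apply ENNReal.ofReal_le_ofReal
    refine hω2.trans ?_
    have hmp : (0 : ℝ) < m := by linarith
    rw [mul_pow (_ * _ * _) (B1 _), mul_pow (_ * _) (√(volume Ω).toReal),
      mul_pow _ (max 1 (eucDiam Ω)), div_pow, Real.sq_sqrt hmp.le, Real.sq_sqrt ENNReal.toReal_nonneg]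
    have hC2 : 1 ≤ max 1 (eucDiam Ω) ^ 2 := one_le_pow₀ hC
    have hnn : 0 ≤ 16 * ((π ^ 2 * B1 (fhatR f)) ^ 2 * (volume Ω).toReal) / m := by positivity
    calc _ = 16 * ((π ^ 2 * B1 (fhatR f)) ^ 2 * (volume Ω).toReal) / m * 1 := by ring
      _ ≤ 16 * ((π ^ 2 * B1 (fhatR f)) ^ 2 * (volume Ω).toReal) / m * max 1 (eucDiam Ω) ^ 2 := by
        gcongr
      _ = _ := by ring

end
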